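/- arXiv:1707.08319 — 2 statements merged into one kernel-verified Lean document; each statement's English description precedes it below -/
import Mathlib

section
/- Let a = 1 (critical case): let c > 0, R > 0, p > 1, and let F : [0,T] → ℝ be C¹ with F(0) ≥ ε₀ > 0 and F'(t) ≥ c F(t)^p (t+R)^{−1} for all t ∈ [0,T]. Then T ≤ exp(C ε₀^{−(p−1)}) for a constant C depending only on c, p, R. -/
open Real Set

/-- A function whose derivative is at least `c F ^ p / (t + R)` never drops below a positive
lower bound of its initial value. -/
lemma le_of_rpow_mul_inv_le_deriv {c R p ε T : ℝ} (hc : 0 < c) (hR : 0 < R) (hε : 0 < ε)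
    {F F' : ℝ → ℝ} (hF : ∀ t ∈ Icc (0:ℝ) T, HasDerivAt F (F' t) t) (h0 : ε ≤ F 0)
    (hF' : ∀ t ∈ Icc (0:ℝ) T, c * F t ^ p * (t + R)⁻¹ ≤ F' t) :
    ∀ t ∈ Icc (0:ℝ) T, ε ≤ F t := by
  refine fun t ht ↦ image_le_of_deriv_right_lt_deriv_boundary' (f := fun _ ↦ ε)
    (f' := fun _ ↦ 0) continuousOn_const (fun x _ ↦ hasDerivWithinAt_const x _ ε) h0
    (fun x hx ↦ (hF x hx).continuousAt.continuousWithinAt)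
    (fun x hx ↦ (hF x (Ico_subset_Icc_self hx)).hasDerivWithinAt) (fun x hx hxε ↦ ?_) ht
  refine lt_of_lt_of_le ?_ (hF' x (Ico_subset_Icc_self hx))
  have hx0 : 0 < x + R := by linarith [hx.1]
  rw [← hxε]
  positivity

/-- Integrated form of `F' ≥ c F ^ p / (t + R)`: the quantity
`F ^ (-(p - 1)) + (p - 1) c log (t + R)` does not exceed its initial value. -/
lemma rpow_add_log_le_of_rpow_mul_inv_le_deriv {c R p T : ℝ} (hR : 0 < R) (hp : 1 < p)
    (hT : 0 ≤ T) {F F' : ℝ → ℝ} (hF : ∀ t ∈ Icc (0:ℝ) T, HasDerivAt F (F' t) t)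
    (hpos : ∀ t ∈ Icc (0:ℝ) T, 0 < F t)
    (hF' : ∀ t ∈ Icc (0:ℝ) T, c * F t ^ p * (t + R)⁻¹ ≤ F' t) :
    F T ^ (-(p - 1)) + (p - 1) * c * log (T + R) ≤ F 0 ^ (-(p - 1)) + (p - 1) * c * log R := by
  have hd : ∀ t ∈ Icc (0:ℝ) T, HasDerivAt
      (fun t ↦ F t ^ (-(p - 1)) + (p - 1) * c * log (t + R))
      (F' t * (-(p - 1)) * F t ^ (-(p - 1) - 1) + (p - 1) * c * (1 / (t + R))) t := by
    intro t ht
    have htR : t + R ≠ 0 := by linarith [ht.1]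
    exact ((hF t ht).rpow_const (Or.inl (hpos t ht).ne')).add
      ((((hasDerivAt_id t).add_const R).log htR).const_mul ((p - 1) * c))
  refine image_le_of_deriv_right_le_deriv_boundary
    (B := fun _ ↦ F 0 ^ (-(p - 1)) + (p - 1) * c * log R) (B' := fun _ ↦ 0)
    (fun x hx ↦ (hd x hx).continuousAt.continuousWithinAt)
    (fun x hx ↦ (hd x (Ico_subset_Icc_self hx)).hasDerivWithinAt) (by simp)
    continuousOn_const (fun x _ ↦ hasDerivWithinAt_const x _ _) (fun x hx ↦ ?_)
    (right_mem_Icc.2 hT)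
  have hx' := Ico_subset_Icc_self hx
  have hFx := hpos x hx'
  have hmul : F x ^ p * F x ^ (-(p - 1) - 1) = 1 := by
    rw [← rpow_add hFx]
    ring_nf
    exact rpow_zero _
  have hkey : c * (x + R)⁻¹ ≤ F' x * F x ^ (-(p - 1) - 1) := by
    calc c * (x + R)⁻¹ = c * F x ^ p * (x + R)⁻¹ * F x ^ (-(p - 1) - 1) := by
          linear_combination (-(c * (x + R)⁻¹)) * hmul
      _ ≤ _ := mul_le_mul_of_nonneg_right (hF' x hx') (by positivity)
  have := mul_le_mul_of_nonneg_left hkey (sub_nonneg.2 hp.le)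
  rw [one_div]
  linarith

/-- Critical ODE blow-up lemma: a `C¹` function with `F(0) ≥ ε₀ > 0` and
`F'(t) ≥ c F(t)^p (t+R)^{−1}` on `[0,T]` forces `T ≤ exp(C ε₀^{−(p−1)})`,
with `C` depending only on `c, p, R`. -/
theorem stmt6 (c R p : ℝ) (hc : 0 < c) (hR : 0 < R) (hp : 1 < p) :
    ∃ C : ℝ, 0 < C ∧
      ∀ ε₀ : ℝ, 0 < ε₀ → ∀ T : ℝ, 0 ≤ T → ∀ F F' : ℝ → ℝ,
        (∀ t ∈ Icc (0:ℝ) T, HasDerivAt F (F' t) t) →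
        ContinuousOn F' (Icc (0:ℝ) T) →
        ε₀ ≤ F 0 →
        (∀ t ∈ Icc (0:ℝ) T, c * F t ^ p * (t + R)⁻¹ ≤ F' t) →
        T ≤ Real.exp (C * ε₀ ^ (-(p - 1))) := by
  have hp' : 0 < p - 1 := sub_pos.2 hp
  have hK : 0 < (p - 1) * c := mul_pos hp' hc
  refine ⟨(1 + R) / ((p - 1) * c), by positivity, fun ε hε T hT F F' hF _ h0 hF' ↦ ?_⟩
  have hpos : ∀ t ∈ Icc (0:ℝ) T, 0 < F t := fun t ht ↦
    hε.trans_le (le_of_rpow_mul_inv_le_deriv hc hR hε hF h0 hF' t ht)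
  have hint := rpow_add_log_le_of_rpow_mul_inv_le_deriv hR hp hT hF hpos hF'
  have hFT : 0 < F T ^ (-(p - 1)) := rpow_pos_of_pos (hpos T (right_mem_Icc.2 hT)) _
  have hF0 : F 0 ^ (-(p - 1)) ≤ ε ^ (-(p - 1)) :=
    rpow_le_rpow_of_nonpos hε h0 (by linarith)
  have hlog : log (1 + T / R) ≤ ε ^ (-(p - 1)) / ((p - 1) * c) := by
    rw [show 1 + T / R = (T + R) / R by field_simp; ring, log_div (by linarith) hR.ne',
      le_div_iff₀ hK]
    linarith
  have hTR : 0 ≤ T / R := by positivity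
  calc T ≤ 1 + (1 + R) * (T / R) := by
        have : R * (T / R) = T := mul_div_cancel₀ T hR.ne'
        linarith
    _ ≤ (1 + T / R) ^ (1 + R) :=
        one_add_mul_self_le_rpow_one_add (by linarith) (by linarith)
    _ = exp (log (1 + T / R) * (1 + R)) := rpow_def_of_pos (by linarith) _
    _ ≤ exp ((1 + R) / ((p - 1) * c) * ε ^ (-(p - 1))) := by
        rw [exp_le_exp, div_mul_comm]
        exact mul_le_mul_of_nonneg_right hlog (by linarith)
end

section
/- Let n ≥ 1, 0 ≤ 1−δ ≤ 1−δ+δ' < n, and define w(x) = |x|^{−(1−δ)/2} (1+|x|²)^{−δ'/4} on ℝⁿ. Then w² belongs to the Muckenhoupt class A₁, i.e., there is a constant C such that for every ball B ⊂ ℝⁿ, the average of w² over B is at most C times the essential infimum of w² over B. -/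
open Real MeasureTheory

/-- The weight `w(x) = |x|^{−(1−δ)/2} ⟨x⟩^{−δ'/2}` with `⟨x⟩ = (1+|x|²)^{1/2}`. -/
noncomputable def wgt (n : ℕ) (δ δ' : ℝ) (x : EuclideanSpace ℝ (Fin n)) : ℝ :=
  ‖x‖ ^ (-(1 - δ) / 2) * (1 + ‖x‖ ^ 2) ^ (-δ' / 4)

open Filter Metric Module

lemma MeasureTheory.isCoboundedUnder_ge_ae {α : Type*} [MeasurableSpace α] (μ : Measure α)
    [NeZero μ] (f : α → ℝ) : (ae μ).IsCoboundedUnder (· ≥ ·) f := by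
  obtain ⟨b, hb⟩ : ∃ b, ∃ᶠ x in ae μ, f x ≤ b := by
    by_contra! h
    have h' : ∀ᵐ x ∂μ, ∀ k : ℕ, (k : ℝ) < f x :=
      ae_all_iff.2 fun k => by simpa using h k
    obtain ⟨x, hx⟩ := h'.exists
    obtain ⟨k, hk⟩ := exists_nat_gt (f x)
    exact lt_asymm hk (hx k)
  exact IsCoboundedUnder.of_frequently_le hb

section PowerWeight

variable {E : Type*} [NormedAddCommGroup E] [NormedSpace ℝ E] [FiniteDimensional ℝ E]
  [MeasurableSpace E] [BorelSpace E] (μ : Measure E) [μ.IsAddHaarMeasure]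

lemma integrableOn_ball_norm_rpow_neg (hd : 1 ≤ finrank ℝ E) {c : ℝ} (hc : c < finrank ℝ E)
    (x : E) (r : ℝ) : IntegrableOn (fun y : E => ‖y‖ ^ (-c)) (ball x r) μ := by
  refine (integrableOn_ball_of_norm_le_rpow (C := 1) (r := ‖x‖ + r) hd hc ?_ ?_).mono_set ?_
  · refine Eventually.of_forall fun y => ?_
    rw [one_mul, Real.norm_of_nonneg (by positivity)]
  · exact (measurable_norm.pow_const _).aestronglyMeasurable
  · exact ball_subset_ball' (by simp [add_comm])

lemma setIntegral_ball_zero_norm_rpow_neg (c : ℝ) {R : ℝ} (hR : 0 < R) :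
    ∫ y in ball (0 : E) R, ‖y‖ ^ (-c) ∂μ =
      R ^ (-c) * R ^ finrank ℝ E * ∫ y in ball (0 : E) 1, ‖y‖ ^ (-c) ∂μ := by
  have h := Measure.setIntegral_comp_smul_of_pos μ (fun y : E => ‖y‖ ^ (-c)) (ball 0 1) hR
  rw [smul_unitBall_of_pos hR, smul_eq_mul, eq_inv_mul_iff_mul_eq₀ (by positivity)] at h
  rw [← h]
  simp only [norm_smul, Real.norm_of_nonneg hR.le, mul_rpow hR.le (norm_nonneg _)]
  rw [integral_const_mul]
  ring

/-- The power weight `‖y‖ ^ (-c)` with `0 ≤ c < dim E` satisfies the `A₁` condition. -/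
theorem exists_setAverage_ball_norm_rpow_neg_le (hd : 1 ≤ finrank ℝ E) {c : ℝ} (hc0 : 0 ≤ c)
    (hc : c < finrank ℝ E) :
    ∃ C : ℝ, 0 < C ∧ ∀ (x : E) (r : ℝ), 0 < r →
      ⨍ y in ball x r, ‖y‖ ^ (-c) ∂μ ≤ C * (‖x‖ + r) ^ (-c) := by
  set K : ℝ := ∫ y in ball (0 : E) 1, ‖y‖ ^ (-c) ∂μ
  have hK : 0 ≤ K := integral_nonneg fun y => by positivity
  set V : ℝ := μ.real (ball (0 : E) 1)
  have hV : 0 < V := ENNReal.toReal_pos (measure_ball_pos μ 0 one_pos).ne' measure_ball_lt_top.ne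
  refine ⟨3 ^ c + 3 ^ finrank ℝ E * K / V, by positivity, fun x r hr => ?_⟩
  have hB : 0 < μ.real (ball x r) :=
    ENNReal.toReal_pos (measure_ball_pos μ x hr).ne' measure_ball_lt_top.ne
  rw [setAverage_eq, smul_eq_mul, inv_mul_le_iff₀ hB]
  set R : ℝ := ‖x‖ + r
  have hR : 0 < R := by positivity
  rcases le_or_gt (2 * r) ‖x‖ with hx | hx
  · calc ∫ y in ball x r, ‖y‖ ^ (-c) ∂μ ≤ ∫ _ in ball x r, (R / 3) ^ (-c) ∂μ := by
          refine setIntegral_mono_on (integrableOn_ball_norm_rpow_neg μ hd hc x r)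
            (integrableOn_const measure_ball_lt_top.ne) measurableSet_ball fun y hy => ?_
          refine rpow_le_rpow_of_nonpos (by positivity) ?_ (neg_nonpos.2 hc0)
          have h1 := norm_sub_norm_le x y
          rw [mem_ball', dist_eq_norm] at hy
          linarith
      _ = μ.real (ball x r) * (3 ^ c * R ^ (-c)) := by
          rw [setIntegral_const, smul_eq_mul, div_rpow hR.le (by norm_num),
            rpow_neg (by norm_num : (0 : ℝ) ≤ 3), div_inv_eq_mul, mul_comm (R ^ (-c))]
      _ ≤ _ := by
          gcongr
          exact le_add_of_nonneg_right (by positivity)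
  · have hBV : μ.real (ball x r) = r ^ finrank ℝ E * V := by
      rw [measureReal_def, μ.addHaar_ball_of_pos x hr, ENNReal.toReal_mul,
        ENNReal.toReal_ofReal (by positivity), ← measureReal_def]
    calc ∫ y in ball x r, ‖y‖ ^ (-c) ∂μ ≤ ∫ y in ball (0 : E) R, ‖y‖ ^ (-c) ∂μ := by
          refine setIntegral_mono_set (integrableOn_ball_norm_rpow_neg μ hd hc 0 R)
            (Eventually.of_forall fun y => by positivity) ?_
          exact (ball_subset_ball' (by simp [R, add_comm])).eventuallyLE
      _ = R ^ (-c) * R ^ finrank ℝ E * K := setIntegral_ball_zero_norm_rpow_neg μ c hR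
      _ ≤ R ^ (-c) * (3 * r) ^ finrank ℝ E * K := by
          gcongr
          linarith
      _ = μ.real (ball x r) * (3 ^ finrank ℝ E * K / V * R ^ (-c)) := by
          rw [hBV, mul_pow]
          field_simp
      _ ≤ _ := by
          gcongr
          exact le_add_of_nonneg_left (by positivity)

end PowerWeight

lemma wgt_sq (n : ℕ) (δ δ' : ℝ) (x : EuclideanSpace ℝ (Fin n)) :
    wgt n δ δ' x ^ 2 = ‖x‖ ^ (-(1 - δ)) * (1 + ‖x‖ ^ 2) ^ (-δ' / 2) := by
  rw [wgt, mul_pow, ← rpow_mul_natCast (norm_nonneg x),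
    ← rpow_mul_natCast (by positivity : (0 : ℝ) ≤ 1 + ‖x‖ ^ 2)]
  congr 2 <;> push_cast <;> ring

lemma rpow_mul_one_add_sq_rpow_anti {a b t R : ℝ} (ha : 0 ≤ a) (hb : 0 ≤ b) (ht : 0 < t)
    (htR : t ≤ R) :
    R ^ (-a) * (1 + R ^ 2) ^ (-b / 2) ≤ t ^ (-a) * (1 + t ^ 2) ^ (-b / 2) := by
  have hR : 0 < R := ht.trans_le htR
  refine mul_le_mul (rpow_le_rpow_of_nonpos ht htR (by linarith))
    (rpow_le_rpow_of_nonpos (by positivity) (by gcongr) (by linarith)) (by positivity)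
    (by positivity)

lemma rpow_mul_one_add_sq_rpow_le {a b t R : ℝ} (hb : 0 ≤ b) (ht : 0 < t) (htR : t ≤ R) :
    t ^ (-a) * (1 + t ^ 2) ^ (-b / 2) ≤
      R ^ (-a) * (1 + R ^ 2) ^ (-b / 2) * R ^ (a + b) * t ^ (-(a + b)) := by
  have hR : 0 < R := ht.trans_le htR
  have hs : ∀ {s : ℝ}, 0 < s → (s ^ 2) ^ (-b / 2) = s ^ (-b) := fun {s} h => by
    rw [← rpow_natCast_mul h.le]
    congr 1
    push_cast
    ring
  have hkey : (1 + t ^ 2) ^ (-b / 2) * R ^ (-b) ≤ (1 + R ^ 2) ^ (-b / 2) * t ^ (-b) := by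
    rw [← hs hR, ← hs ht, ← mul_rpow (by positivity) (by positivity),
      ← mul_rpow (by positivity) (by positivity)]
    refine rpow_le_rpow_of_nonpos (by positivity) ?_ (by linarith)
    nlinarith [pow_le_pow_left₀ ht.le htR 2]
  calc t ^ (-a) * (1 + t ^ 2) ^ (-b / 2)
      = t ^ (-a) * R ^ b * ((1 + t ^ 2) ^ (-b / 2) * R ^ (-b)) := by
        rw [rpow_neg hR.le b]
        field_simp
    _ ≤ t ^ (-a) * R ^ b * ((1 + R ^ 2) ^ (-b / 2) * t ^ (-b)) := by gcongr
    _ = _ := by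
        rw [neg_add, rpow_add ht, rpow_add hR, rpow_neg hR.le a]
        field_simp

/-- `w² ∈ A₁`: the average of `w²` over any ball is at most a constant times the
essential infimum of `w²` over the ball. -/
theorem stmt11 (n : ℕ) (hn : 1 ≤ n) (δ δ' : ℝ)
    (h1 : 0 ≤ 1 - δ) (h2 : 1 - δ ≤ 1 - δ + δ') (h3 : 1 - δ + δ' < n) :
    ∃ C : ℝ, 0 < C ∧
      ∀ (x₀ : EuclideanSpace ℝ (Fin n)) (r : ℝ), 0 < r →
        ⨍ y in Metric.ball x₀ r, (wgt n δ δ' y) ^ 2 ∂volume ≤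
          C * essInf (fun y => (wgt n δ δ' y) ^ 2) (volume.restrict (Metric.ball x₀ r)) := by
  have hb : 0 ≤ δ' := by linarith
  have hd : 1 ≤ finrank ℝ (EuclideanSpace ℝ (Fin n)) := by simpa using hn
  have hc : 1 - δ + δ' < finrank ℝ (EuclideanSpace ℝ (Fin n)) := by simpa using h3
  have : Nontrivial (EuclideanSpace ℝ (Fin n)) := Module.nontrivial_of_finrank_pos (R := ℝ) hd
  obtain ⟨C, hC, havg⟩ := exists_setAverage_ball_norm_rpow_neg_le
    (volume : Measure (EuclideanSpace ℝ (Fin n))) hd (h1.trans h2) hc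
  refine ⟨C, hC, fun x r hr => ?_⟩
  set R : ℝ := ‖x‖ + r
  have hR : 0 < R := by positivity
  set m : ℝ := R ^ (-(1 - δ)) * (1 + R ^ 2) ^ (-δ' / 2)
  have hm : 0 ≤ m := by positivity
  have hmem : ∀ᵐ y ∂volume.restrict (ball x r), 0 < ‖y‖ ∧ ‖y‖ ≤ R := by
    filter_upwards [ae_restrict_mem measurableSet_ball,
      ae_restrict_of_ae (Measure.ae_ne volume (0 : EuclideanSpace ℝ (Fin n)))] with y hy hy0
    refine ⟨norm_pos_iff.2 hy0, ?_⟩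
    rw [mem_ball, dist_eq_norm] at hy
    linarith [norm_le_norm_add_norm_sub' y x]
  have hinf : m ≤ essInf (fun y => wgt n δ δ' y ^ 2) (volume.restrict (ball x r)) := by
    have : NeZero (volume.restrict (ball x r)) :=
      ⟨Measure.restrict_eq_zero.not.2 (measure_ball_pos volume x hr).ne'⟩
    refine le_essInf_of_ae_le m ?_ (isCoboundedUnder_ge_ae _ _)
    filter_upwards [hmem] with y hy
    rw [wgt_sq]
    exact rpow_mul_one_add_sq_rpow_anti h1 hb hy.1 hy.2
  calc ⨍ y in ball x r, wgt n δ δ' y ^ 2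
      ≤ ⨍ y in ball x r, m * R ^ (1 - δ + δ') * ‖y‖ ^ (-(1 - δ + δ')) := by
        rw [setAverage_eq, setAverage_eq, smul_eq_mul, smul_eq_mul]
        gcongr ?_ * ?_
        refine integral_mono_of_nonneg (Eventually.of_forall fun y => by positivity)
          ((integrableOn_ball_norm_rpow_neg volume hd hc x r).const_mul _) ?_
        filter_upwards [hmem] with y hy
        rw [wgt_sq]
        exact rpow_mul_one_add_sq_rpow_le hb hy.1 hy.2
    _ = m * R ^ (1 - δ + δ') * ⨍ y in ball x r, ‖y‖ ^ (-(1 - δ + δ')) := by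
        rw [setAverage_eq, setAverage_eq, integral_const_mul, smul_eq_mul, smul_eq_mul]
        ring
    _ ≤ m * R ^ (1 - δ + δ') * (C * R ^ (-(1 - δ + δ'))) := by
        gcongr
        exact havg x r hr
    _ = C * m := by
        rw [rpow_neg hR.le]
        field_simp
    _ ≤ _ := by gcongr
end
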